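/- arXiv:1910.02921 — 3 statements merged into one kernel-verified Lean document; each statement's English description precedes it below -/
import Mathlib

section
/- Let (X, dist) be a metric space, μ a Borel measure on X, x₀ ∈ X, and c₁, R > 0 such that μ(B(x₀,ρ)) ≤ c₁ρ² for every 0 < ρ ≤ R. Fix β, c > 0, 0 < ρ₀ < R, and 1 ≤ p < 2. Then there exists a constant C (depending only on c₁, R, β, c, ρ₀, p) such that for every ε ∈ (0, 1/2) with ε^β ≤ ρ₀, and every measurable f : X → ℝ satisfying ∫_{B(x₀,R)} f² dμ ≤ c(1 + |log ε|) and ∫_{B(x₀,R)\B(x₀,ρ)} f² dμ ≤ c(1 + |log ρ|) for every ρ ∈ [ε^β, ρ₀], one has ∫_{B(x₀,R)} |f|^p dμ ≤ C. -/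
open MeasureTheory

/-- Young's inequality with weight `s ^ ((2 - p) / p)`. -/
theorem rpow_le_weight_mul_sq_add_inv {p s y : ℝ} (hp : 1 ≤ p) (hp2 : p < 2)
    (hs : 0 < s) (hy : 0 ≤ y) :
    y ^ p ≤ s ^ ((2 - p) / p) * y ^ 2 + s⁻¹ := by
  have hp0 : 0 < p := by linarith
  set z := s⁻¹ ^ p⁻¹ with hz
  have hz0 : 0 < z := by positivity
  have hzp : z ^ p = s⁻¹ := Real.rpow_inv_rpow (by positivity) hp0.ne'
  have hw : s ^ ((2 - p) / p) * z ^ (2 - p) = 1 := by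
    rw [hz, ← Real.rpow_mul (by positivity), Real.inv_rpow hs.le,
      show p⁻¹ * (2 - p) = (2 - p) / p by ring]
    exact mul_inv_cancel₀ (by positivity)
  rcases le_total y z with h | h
  · have h1 : y ^ p ≤ z ^ p := Real.rpow_le_rpow hy h hp0.le
    have h2 : 0 ≤ s ^ ((2 - p) / p) * y ^ 2 := by positivity
    linarith
  · have hy0 : 0 < y := hz0.trans_le h
    have h1 : z ^ (2 - p) ≤ y ^ (2 - p) := Real.rpow_le_rpow hz0.le h (by linarith)
    have h2 : y ^ 2 = y ^ (2 - p) * y ^ p := by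
      rw [← Real.rpow_add hy0, ← Real.rpow_natCast]
      norm_num
    have h3 : 1 ≤ s ^ ((2 - p) / p) * y ^ (2 - p) :=
      hw ▸ mul_le_mul_of_nonneg_left h1 (by positivity)
    have h4 : 0 < s⁻¹ := by positivity
    rw [h2, ← mul_assoc]
    nlinarith [Real.rpow_pos_of_pos hy0 p]

/-- Geometric annuli and the center cover a ball. -/
theorem ball_subset_singleton_union_iUnion_annuli {X : Type*} [MetricSpace X] (x₀ : X) {R q : ℝ}
    (hR : 0 < R) (hq0 : 0 < q) (hq1 : q < 1) :
    Metric.ball x₀ R ⊆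
      {x₀} ∪ ⋃ k : ℕ, Metric.ball x₀ (R * q ^ k) \ Metric.ball x₀ (R * q ^ (k + 1)) := by
  intro x hx
  rcases eq_or_ne x x₀ with h | h
  · exact Or.inl h
  · refine Or.inr (Set.mem_iUnion.2 ?_)
    have hd : 0 < dist x x₀ / R := div_pos (dist_pos.2 h) hR
    have hex : ∃ k : ℕ, R * q ^ (k + 1) ≤ dist x x₀ := by
      obtain ⟨n, hn⟩ := exists_pow_lt_of_lt_one hd hq1
      refine ⟨n, ?_⟩
      rw [lt_div_iff₀ hR, mul_comm] at hn
      refine le_trans ?_ hn.le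
      exact mul_le_mul_of_nonneg_left
        (pow_le_pow_of_le_one hq0.le hq1.le (Nat.le_succ n)) hR.le
    classical
    refine ⟨Nat.find hex, ?_, by simpa [Metric.mem_ball] using Nat.find_spec hex⟩
    rcases hk : Nat.find hex with _ | k
    · simpa using hx
    · exact not_le.1 (Nat.find_min hex (hk ▸ Nat.lt_succ_self k))

/-- A point at which balls have at most quadratic volume is not an atom. -/
theorem measure_singleton_eq_zero_of_ball_le {X : Type*} [MetricSpace X] [MeasurableSpace X]
    (μ : Measure X) (x₀ : X) {c₁ R : ℝ} (hR : 0 < R)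
    (hμ : ∀ ρ : ℝ, 0 < ρ → ρ ≤ R → μ (Metric.ball x₀ ρ) ≤ ENNReal.ofReal (c₁ * ρ ^ 2)) :
    μ {x₀} = 0 := by
  have hlim : Filter.Tendsto (fun ρ : ℝ => ENNReal.ofReal (c₁ * ρ ^ 2))
      (nhdsWithin 0 (Set.Ioi 0)) (nhds 0) := by
    have : Continuous fun ρ : ℝ => ENNReal.ofReal (c₁ * ρ ^ 2) :=
      ENNReal.continuous_ofReal.comp (by fun_prop)
    simpa using (this.tendsto 0).mono_left nhdsWithin_le_nhds
  refine le_antisymm (ge_of_tendsto hlim ?_) bot_le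
  filter_upwards [Ioc_mem_nhdsGT hR] with ρ hρ
  exact (measure_mono (by simpa using hρ.1)).trans (hμ ρ hρ.1 hρ.2)

/-- Logarithmic energy bounds on the annuli of inner radius at least `ε ^ β` extend to all
smaller inner radii. -/
theorem lintegral_annulus_le_of_log_bounds {X : Type*} [MetricSpace X] [MeasurableSpace X]
    (μ : Measure X) (x₀ : X) {R β c ρ₀ ε : ℝ} (hβ : 0 < β) (hc : 0 < c)
    (hε : 0 < ε) (hε1 : ε < 1) (g : X → ENNReal)
    (hball : ∫⁻ x in Metric.ball x₀ R, g x ∂μ ≤ ENNReal.ofReal (c * (1 + |Real.log ε|)))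
    (hann : ∀ ρ : ℝ, ε ^ β ≤ ρ → ρ ≤ ρ₀ →
      ∫⁻ x in Metric.ball x₀ R \ Metric.ball x₀ ρ, g x ∂μ
        ≤ ENNReal.ofReal (c * (1 + |Real.log ρ|)))
    {ρ : ℝ} (hρ : 0 < ρ) (hρρ₀ : ρ ≤ ρ₀) :
    ∫⁻ x in Metric.ball x₀ R \ Metric.ball x₀ ρ, g x ∂μ
      ≤ ENNReal.ofReal (c * (1 + (1 + β⁻¹) * |Real.log ρ|)) := by
  have hβ' : 0 < β⁻¹ := inv_pos.2 hβ
  rcases le_or_gt (ε ^ β) ρ with h | h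
  · refine (hann ρ h hρρ₀).trans (ENNReal.ofReal_le_ofReal ?_)
    gcongr
    nlinarith [abs_nonneg (Real.log ρ)]
  · refine (lintegral_mono_set Set.sdiff_subset).trans
      (hball.trans (ENNReal.ofReal_le_ofReal ?_))
    have hlogε : Real.log ε < 0 := Real.log_neg hε hε1
    have hlog : Real.log ρ < β * Real.log ε := by
      rw [← Real.log_rpow hε]
      exact Real.log_lt_log hρ h
    have hlogρ : Real.log ρ < 0 := hlog.trans (mul_neg_of_pos_of_neg hβ hlogε)
    gcongr
    rw [abs_of_neg hlogε, abs_of_neg hlogρ]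
    have : β⁻¹ * Real.log ρ ≤ Real.log ε := by
      rw [inv_mul_le_iff₀ hβ]
      exact hlog.le
    linarith

/-- Logarithmic factors are harmless in the geometric series of annular contributions. -/
theorem summable_annular_bounds {R q s a b d : ℝ} (hq0 : 0 < q) (hq1 : q < 1) (hR : 0 < R)
    (hs : 0 < s) :
    Summable fun k : ℕ =>
      (q ^ k) ^ s * (a * (1 + b * |Real.log (R * q ^ (k + 1))|)) + d * q ^ k := by
  have hu0 : 0 ≤ q ^ s := by positivity
  have hu1 : q ^ s < 1 := Real.rpow_lt_one hq0.le hq1 hs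
  have hgeom : Summable fun k : ℕ => (q ^ s) ^ k := summable_geometric_of_lt_one hu0 hu1
  have hlin : Summable fun k : ℕ => (k : ℝ) * (q ^ s) ^ k := by
    simpa using summable_pow_mul_geometric_of_norm_lt_one 1
      (by rwa [Real.norm_of_nonneg hu0])
  refine Summable.add ?_ ((summable_geometric_of_lt_one hq0.le hq1).mul_left d)
  have hpow : ∀ k : ℕ, (q ^ k) ^ s = (q ^ s) ^ k := fun k => (Real.rpow_pow_comm hq0.le s k).symm
  refine Summable.of_norm_bounded
    (g := fun k : ℕ => |a| * (1 + |b| * (|Real.log R| + |Real.log q|)) * (q ^ s) ^ k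
      + |a| * |b| * |Real.log q| * (k * (q ^ s) ^ k))
    ((hgeom.mul_left _).add (hlin.mul_left _)) fun k => ?_
  have hlog : |Real.log (R * q ^ (k + 1))| ≤ |Real.log R| + (k + 1) * |Real.log q| := by
    rw [Real.log_mul hR.ne' (by positivity), Real.log_pow]
    refine (abs_add_le _ _).trans_eq ?_
    rw [abs_mul, Nat.abs_cast, Nat.cast_succ]
  rw [hpow, norm_mul, norm_mul, Real.norm_of_nonneg (pow_nonneg hu0 k), Real.norm_eq_abs,
    Real.norm_eq_abs]
  have hb : |1 + b * (|Real.log (R * q ^ (k + 1))|)|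
      ≤ 1 + |b| * (|Real.log R| + (k + 1) * |Real.log q|) := by
    refine (abs_add_le _ _).trans ?_
    rw [abs_one, abs_mul, abs_abs]
    gcongr
  calc (q ^ s) ^ k * (|a| * |1 + b * (|Real.log (R * q ^ (k + 1))|)|)
      ≤ (q ^ s) ^ k * (|a| * (1 + |b| * (|Real.log R| + (k + 1) * |Real.log q|))) := by gcongr
    _ = _ := by ring

/-- The contribution of one annulus. -/
theorem lintegral_rpow_le_of_lintegral_sq_le {X : Type*} [MeasurableSpace X]
    {μ : Measure X} {A : Set X} {f : X → ℝ} (hf : Measurable f) {p s E V : ℝ}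
    (hp : 1 ≤ p) (hp2 : p < 2) (hs : 0 < s) (hE : 0 ≤ E) (hV : 0 ≤ V)
    (hfE : ∫⁻ x in A, ENNReal.ofReal ((f x) ^ 2) ∂μ ≤ ENNReal.ofReal E)
    (hA : μ A ≤ ENNReal.ofReal V) :
    ∫⁻ x in A, ENNReal.ofReal (|f x| ^ p) ∂μ
      ≤ ENNReal.ofReal (s ^ ((2 - p) / p) * E + s⁻¹ * V) := by
  calc ∫⁻ x in A, ENNReal.ofReal (|f x| ^ p) ∂μ
      ≤ ∫⁻ x in A, (ENNReal.ofReal (s ^ ((2 - p) / p)) * ENNReal.ofReal ((f x) ^ 2)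
          + ENNReal.ofReal s⁻¹) ∂μ := by
        refine lintegral_mono fun x => ?_
        rw [← ENNReal.ofReal_mul (by positivity), ← ENNReal.ofReal_add (by positivity)
          (by positivity), ← sq_abs (f x)]
        exact ENNReal.ofReal_le_ofReal
          (rpow_le_weight_mul_sq_add_inv hp hp2 hs (abs_nonneg (f x)))
    _ = ENNReal.ofReal (s ^ ((2 - p) / p)) * ∫⁻ x in A, ENNReal.ofReal ((f x) ^ 2) ∂μ
          + ENNReal.ofReal s⁻¹ * μ A := by
        rw [lintegral_add_right _ measurable_const, lintegral_const_mul _ (by fun_prop),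
          setLIntegral_const]
    _ ≤ ENNReal.ofReal (s ^ ((2 - p) / p)) * ENNReal.ofReal E
          + ENNReal.ofReal s⁻¹ * ENNReal.ofReal V := by gcongr
    _ = _ := by
        rw [← ENNReal.ofReal_mul (by positivity), ← ENNReal.ofReal_mul (by positivity),
          ← ENNReal.ofReal_add (by positivity) (by positivity)]

/-- A Struwe-type lemma.  On a metric measure space with quadratic
volume growth of balls centered at `x₀`, logarithmic bounds for `∫ f²` on the
ball `B(x₀,R)` and on the annuli `B(x₀,R) \ B(x₀,ρ)`, `ε^β ≤ ρ ≤ ρ₀`, imply a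
uniform bound for `∫ |f|ᵖ` (`1 ≤ p < 2`), with a constant independent of `ε`
and of `f`. -/
theorem struwe_lemma
    {X : Type*} [MetricSpace X] [MeasurableSpace X] [BorelSpace X]
    (μ : Measure X) (x₀ : X) (c₁ R : ℝ) (hc₁ : 0 < c₁) (hR : 0 < R)
    (hμ : ∀ ρ : ℝ, 0 < ρ → ρ ≤ R → μ (Metric.ball x₀ ρ) ≤ ENNReal.ofReal (c₁ * ρ ^ 2))
    (β c ρ₀ p : ℝ) (hβ : 0 < β) (hc : 0 < c) (hρ₀ : 0 < ρ₀) (hρ₀R : ρ₀ < R)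
    (hp1 : 1 ≤ p) (hp2 : p < 2) :
    ∃ C : ℝ, ∀ ε : ℝ, 0 < ε → ε < 1/2 → ε ^ β ≤ ρ₀ →
      ∀ f : X → ℝ, Measurable f →
        (∫⁻ x in Metric.ball x₀ R, ENNReal.ofReal ((f x) ^ 2) ∂μ
            ≤ ENNReal.ofReal (c * (1 + |Real.log ε|))) →
        (∀ ρ : ℝ, ε ^ β ≤ ρ → ρ ≤ ρ₀ →
          ∫⁻ x in Metric.ball x₀ R \ Metric.ball x₀ ρ, ENNReal.ofReal ((f x) ^ 2) ∂μ
            ≤ ENNReal.ofReal (c * (1 + |Real.log ρ|))) →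
        ∫⁻ x in Metric.ball x₀ R, ENNReal.ofReal (|f x| ^ p) ∂μ ≤ ENNReal.ofReal C := by
  set q := ρ₀ / R with hq
  have hq0 : 0 < q := div_pos hρ₀ hR
  have hq1 : q < 1 := (div_lt_one hR).2 hρ₀R
  have hRq : R * q = ρ₀ := mul_div_cancel₀ _ hR.ne'
  have hβ' : 0 < β⁻¹ := inv_pos.2 hβ
  let C : ℕ → ℝ := fun k =>
    (q ^ k) ^ ((2 - p) / p) * (c * (1 + (1 + β⁻¹) * |Real.log (R * q ^ (k + 1))|))
      + (c₁ * R ^ 2) * q ^ k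
  have hC : Summable C :=
    summable_annular_bounds hq0 hq1 hR (div_pos (by linarith) (by linarith))
  have hC0 : ∀ k, 0 ≤ C k := fun k => by positivity
  refine ⟨∑' k, C k, fun ε hε hε2 _ f hf hball hann => ?_⟩
  calc ∫⁻ x in Metric.ball x₀ R, ENNReal.ofReal (|f x| ^ p) ∂μ
      ≤ ∫⁻ x in {x₀}, ENNReal.ofReal (|f x| ^ p) ∂μ
        + ∫⁻ x in ⋃ k : ℕ, Metric.ball x₀ (R * q ^ k) \ Metric.ball x₀ (R * q ^ (k + 1)),
            ENNReal.ofReal (|f x| ^ p) ∂μ :=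
        (lintegral_mono_set (ball_subset_singleton_union_iUnion_annuli x₀ hR hq0 hq1)).trans
          (lintegral_union_le _ _ _)
    _ = ∫⁻ x in ⋃ k : ℕ, Metric.ball x₀ (R * q ^ k) \ Metric.ball x₀ (R * q ^ (k + 1)),
            ENNReal.ofReal (|f x| ^ p) ∂μ := by
        rw [setLIntegral_measure_zero _ _ (measure_singleton_eq_zero_of_ball_le μ x₀ hR hμ),
          zero_add]
    _ ≤ ∑' k : ℕ, ∫⁻ x in Metric.ball x₀ (R * q ^ k) \ Metric.ball x₀ (R * q ^ (k + 1)),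
            ENNReal.ofReal (|f x| ^ p) ∂μ := lintegral_iUnion_le _ _
    _ ≤ ∑' k : ℕ, ENNReal.ofReal (C k) := by
        refine ENNReal.tsum_le_tsum fun k => ?_
        have hqk : 0 < q ^ k := by positivity
        have hle : R * q ^ k ≤ R := mul_le_of_le_one_right hR.le (pow_le_one₀ hq0.le hq1.le)
        have hρ : R * q ^ (k + 1) ≤ ρ₀ := by
          rw [pow_succ', ← mul_assoc, hRq]
          exact mul_le_of_le_one_right hρ₀.le (pow_le_one₀ hq0.le hq1.le)
        have hE := (lintegral_mono_set
            (Set.sdiff_subset_sdiff_left (Metric.ball_subset_ball hle))).trans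
          (lintegral_annulus_le_of_log_bounds μ x₀ hβ hc hε (by linarith) _ hball hann
            (by positivity) hρ)
        have hV := (measure_mono (μ := μ)
            (Set.sdiff_subset (t := Metric.ball x₀ (R * q ^ (k + 1))))).trans
          (hμ (R * q ^ k) (by positivity) hle)
        refine (lintegral_rpow_le_of_lintegral_sq_le hf hp1 hp2 hqk (by positivity)
          (by positivity) hE hV).trans_eq ?_
        congr 2
        field_simp
    _ = ENNReal.ofReal (∑' k, C k) := (ENNReal.ofReal_tsum_of_nonneg hC0 hC).symm
end

section
/- Let c₂ > 0, c₃ ≥ 0, set c₄ := 4π/c₂, and let r₀ > 0 satisfy c₃r₀² ≤ 1. For ε, r > 0 define λ_ε(r) := inf over s ∈ (0,1] of [ (c₂/(4ε))(1−s)² + s²(π/r)(1−c₃r²) ], and Λ_ε(σ) := ∫₀^σ λ_ε(r) dr. Then there exists a constant C ≥ 0, depending only on c₂, c₃, r₀, such that for every ε > 0 and every σ ∈ (0, r₀]: Λ_ε(σ) ≥ π·log(1 + σ/(c₄ε)) − Cσ², and consequently Λ_ε(σ) ≥ π(log(σ/ε) − C). -/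
/-- The lower-bound profile `λ_ε(r)` of the vortex-ball construction:
the infimum over `s ∈ (0,1]` of `(c₂/(4ε))(1−s)² + s²(π/r)(1−c₃r²)`. -/
noncomputable def lamProfile (c₂ c₃ ε r : ℝ) : ℝ :=
  sInf ((fun s : ℝ => c₂ / (4 * ε) * (1 - s) ^ 2 + s ^ 2 * (Real.pi / r) * (1 - c₃ * r ^ 2)) ''
    Set.Ioc 0 1)

section

open Set

lemma sInf_image_quadratic_Ioc {a b : ℝ} (ha : 0 < a) (hb : 0 ≤ b) :
    sInf ((fun s : ℝ => a * (1 - s) ^ 2 + s ^ 2 * b) '' Ioc 0 1) = a * b / (a + b) := by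
  have hab : 0 < a + b := by linarith
  refine IsLeast.csInf_eq ⟨⟨a / (a + b), ⟨by positivity, ?_⟩, ?_⟩, ?_⟩
  · rw [div_le_one hab]
    linarith
  · field_simp
    ring
  · rintro _ ⟨s, -, rfl⟩
    have h : a * (1 - s) ^ 2 + s ^ 2 * b = a * b / (a + b) + (a + b) * (s - a / (a + b)) ^ 2 := by
      field_simp
      ring
    have : 0 ≤ (a + b) * (s - a / (a + b)) ^ 2 := by positivity
    simp only
    linarith

lemma lamProfile_eq_div {c₂ c₃ ε r : ℝ} (hc₂ : 0 < c₂) (hε : 0 < ε) (hr : 0 < r)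
    (hr' : c₃ * r ^ 2 ≤ 1) :
    lamProfile c₂ c₃ ε r =
      Real.pi * (1 - c₃ * r ^ 2) / (r + 4 * Real.pi / c₂ * ε * (1 - c₃ * r ^ 2)) := by
  have hq : 0 ≤ 1 - c₃ * r ^ 2 := by linarith
  have ha : 0 < c₂ / (4 * ε) := by positivity
  have hpi := Real.pi_pos
  have hb : 0 ≤ Real.pi / r * (1 - c₃ * r ^ 2) := by positivity
  unfold lamProfile
  simp only [mul_assoc (_ ^ 2)]
  rw [sInf_image_quadratic_Ioc ha hb]
  generalize 1 - c₃ * r ^ 2 = q at *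
  rw [div_eq_div_iff (by positivity) (by positivity)]
  field_simp

lemma sub_le_div_of_le_one {δ c r : ℝ} (hδ : 0 < δ) (hc : 0 ≤ c) (hr : 0 ≤ r)
    (hr' : c * r ^ 2 ≤ 1) (hden : 0 < r + δ * (1 - c * r ^ 2)) :
    1 / (r + δ) - c * r ≤ (1 - c * r ^ 2) / (r + δ * (1 - c * r ^ 2)) := by
  have hq : 0 ≤ 1 - c * r ^ 2 := by linarith
  have hcr : 0 ≤ c * r ^ 2 := by positivity
  calc 1 / (r + δ) - c * r ≤ (1 - c * r ^ 2) / (r + δ) := by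
        rw [le_div_iff₀ (by positivity), sub_mul, one_div_mul_cancel (by positivity)]
        have : 0 ≤ c * r * δ := by positivity
        nlinarith
    _ ≤ _ := div_le_div_of_nonneg_left hq hden (by nlinarith)

lemma integral_one_div_add_sub_mul {δ c σ : ℝ} (hδ : 0 < δ) (hσ : 0 < σ) :
    ∫ r in (0:ℝ)..σ, (1 / (r + δ) - c * r) = Real.log (1 + σ / δ) - c * σ ^ 2 / 2 := by
  have hne : ∀ r ∈ uIcc 0 σ, r + δ ≠ 0 := by
    intro r hr
    rw [uIcc_of_le hσ.le] at hr
    linarith [hr.1]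
  rw [intervalIntegral.integral_sub, intervalIntegral.integral_const_mul, integral_id,
    intervalIntegral.integral_comp_add_right (fun x => 1 / x), integral_one_div_of_pos]
  · rw [zero_add, add_div, div_self hδ.ne', add_comm]
    ring
  · linarith
  · linarith
  · exact (continuousOn_const.div (by fun_prop) hne).intervalIntegrable
  · exact (by fun_prop : Continuous fun r : ℝ => c * r).intervalIntegrable _ _

lemma log_sub_le_integral_lamProfile {c₂ c₃ ε σ : ℝ} (hc₂ : 0 < c₂) (hc₃ : 0 ≤ c₃) (hε : 0 < ε)
    (hσ : 0 < σ) (hσ' : c₃ * σ ^ 2 ≤ 1) :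
    Real.pi * (Real.log (1 + σ / (4 * Real.pi / c₂ * ε)) - c₃ * σ ^ 2 / 2) ≤
      ∫ r in (0:ℝ)..σ, lamProfile c₂ c₃ ε r := by
  have hpi := Real.pi_pos
  have hδ : 0 < 4 * Real.pi / c₂ * ε := by positivity
  have hbound : ∀ r ∈ Icc 0 σ, c₃ * r ^ 2 ≤ 1 := fun r hr =>
    (mul_le_mul_of_nonneg_left (pow_le_pow_left₀ hr.1 hr.2 2) hc₃).trans hσ'
  have hcongr : ∫ r in (0:ℝ)..σ, lamProfile c₂ c₃ ε r = ∫ r in (0:ℝ)..σ,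
      Real.pi * ((1 - c₃ * r ^ 2) / (r + 4 * Real.pi / c₂ * ε * (1 - c₃ * r ^ 2))) := by
    refine intervalIntegral.integral_congr_ae (Filter.Eventually.of_forall fun r hr => ?_)
    rw [uIoc_of_le hσ.le] at hr
    rw [lamProfile_eq_div hc₂ hε hr.1 (hbound r ⟨hr.1.le, hr.2⟩), mul_div_assoc]
  rw [hcongr, intervalIntegral.integral_const_mul, ← integral_one_div_add_sub_mul hδ hσ]
  generalize 4 * Real.pi / c₂ * ε = δ at *
  have hden : ∀ r ∈ Icc 0 σ, 0 < r + δ * (1 - c₃ * r ^ 2) := by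
    intro r hr
    rcases hr.1.eq_or_lt with rfl | h
    · simpa using hδ
    · have := mul_nonneg hδ.le (sub_nonneg.2 (hbound r hr))
      linarith
  refine mul_le_mul_of_nonneg_left (intervalIntegral.integral_mono_on hσ.le ?_ ?_ fun r hr =>
    sub_le_div_of_le_one hδ hc₃ hr.1 (hbound r hr) (hden r hr)) hpi.le
  · refine ContinuousOn.intervalIntegrable_of_Icc hσ.le ?_
    refine (continuousOn_const.div (by fun_prop) fun r hr => ?_).sub (by fun_prop)
    linarith [hr.1]
  · exact ContinuousOn.intervalIntegrable_of_Icc hσ.le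
      (ContinuousOn.div (by fun_prop) (by fun_prop) fun r hr => (hden r hr).ne')

end

/-- with `Λ_ε(σ) = ∫₀^σ λ_ε(r) dr` and `c₄ = 4π/c₂`, there is a
constant `C ≥ 0` depending only on `c₂, c₃, r₀` such that for all `ε > 0` and
`σ ∈ (0, r₀]` one has `Λ_ε(σ) ≥ π log(1 + σ/(c₄ ε)) − Cσ²` and consequently
`Λ_ε(σ) ≥ π (log(σ/ε) − C)`. -/
theorem lamProfile_integral_log_lower_bound
    (c₂ c₃ r₀ : ℝ) (hc₂ : 0 < c₂) (hc₃ : 0 ≤ c₃)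
    (hr₀ : 0 < r₀) (hr₀' : c₃ * r₀ ^ 2 ≤ 1) :
    ∃ C : ℝ, 0 ≤ C ∧ ∀ ε : ℝ, 0 < ε → ∀ σ : ℝ, 0 < σ → σ ≤ r₀ →
      (Real.pi * Real.log (1 + σ / ((4 * Real.pi / c₂) * ε)) - C * σ ^ 2 ≤
        ∫ r in (0:ℝ)..σ, lamProfile c₂ c₃ ε r) ∧
      (Real.pi * (Real.log (σ / ε) - C) ≤ ∫ r in (0:ℝ)..σ, lamProfile c₂ c₃ ε r) := by
  have hpi := Real.pi_pos
  refine ⟨Real.pi * c₃ / 2 + |Real.log (4 * Real.pi / c₂)| + 1 / 2, by positivity, ?_⟩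
  intro ε hε σ hσ hσr
  have hσ' : c₃ * σ ^ 2 ≤ 1 :=
    (mul_le_mul_of_nonneg_left (pow_le_pow_left₀ hσ.le hσr 2) hc₃).trans hr₀'
  have key := log_sub_le_integral_lamProfile hc₂ hc₃ hε hσ hσ'
  refine ⟨le_trans ?_ key, le_trans (mul_le_mul_of_nonneg_left ?_ hpi.le) key⟩
  · have : 0 ≤ (|Real.log (4 * Real.pi / c₂)| + 1 / 2) * σ ^ 2 := by positivity
    linarith
  · have hlog : Real.log (σ / ε) - Real.log (4 * Real.pi / c₂) ≤
        Real.log (1 + σ / (4 * Real.pi / c₂ * ε)) := by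
      rw [← Real.log_div (by positivity) (by positivity), div_div, mul_comm ε]
      exact Real.log_le_log (by positivity) (by linarith)
    have : 0 ≤ Real.pi * c₃ := by positivity
    linarith [le_abs_self (Real.log (4 * Real.pi / c₂))]
end

section
/- Let (X, dist) be a metric space, let a₁, …, a_m ∈ X be distinct and d₁, …, d_m nonzero integers, let b₁, …, b_K ∈ X and e₁, …, e_K be integers, and let s > 0 with s ≤ 1/2 and dist(a_ℓ, a_{ℓ'}) > 4s for all ℓ ≠ ℓ'. Assume that for every function f : X → ℝ with sup_X |f| ≤ 1 and Lipschitz constant ≤ 1 one has |Σ_{k=1}^K e_k f(b_k) − Σ_{ℓ=1}^m d_ℓ f(a_ℓ)| ≤ s. Then: (i) for every ℓ, |d_ℓ| ≤ Σ over {k : dist(b_k, a_ℓ) ≤ 2s and sign(e_k) = sign(d_ℓ)} of |e_k|. (ii) If in addition Σ_{k=1}^K |e_k| ≤ Σ_{ℓ=1}^m |d_ℓ|, then Σ_k |e_k| = Σ_ℓ |d_ℓ|; every k with e_k ≠ 0 satisfies dist(b_k, a_ℓ) ≤ 2s and sign(e_k) = sign(d_ℓ) for some ℓ; and for every ℓ,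 Σ over {k : dist(b_k, a_ℓ) ≤ 2s} of e_k equals d_ℓ. -/
/-- The cone of height `r` over the ball of radius `r` around `p`. -/
def distCone {X : Type*} [MetricSpace X] (p : X) (r : ℝ) (x : X) : ℝ :=
  max (r - dist x p) 0

section distCone

variable {X : Type*} [MetricSpace X] (p : X) {r : ℝ}

lemma distCone_nonneg (x : X) : 0 ≤ distCone p r x := le_max_right _ _

lemma distCone_le (hr : 0 ≤ r) (x : X) : distCone p r x ≤ r :=
  max_le (by linarith [dist_nonneg (x := x) (y := p)]) hr

lemma distCone_self (hr : 0 ≤ r) : distCone p r p = r := by simp [distCone, hr]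

lemma distCone_eq_zero {x : X} (h : r ≤ dist x p) : distCone p r x = 0 :=
  max_eq_right (by linarith)

lemma lipschitzWith_distCone : LipschitzWith 1 (distCone p r) := by
  refine LipschitzWith.max_const (LipschitzWith.of_le_add fun x y => ?_) 0
  linarith [dist_triangle y x p, dist_comm x y]

end distCone

lemma sign_mul_le_ite_abs (d n : ℤ) (hd : d ≠ 0) :
    d.sign * n ≤ if n.sign = d.sign then |n| else 0 := by
  rcases lt_or_gt_of_ne hd with h | h <;> rcases lt_trichotomy n 0 with h' | h' | h' <;>
    simp [Int.sign_eq_neg_one_of_neg, Int.sign_eq_one_of_pos, abs_of_neg, abs_of_pos, h, h'] <;>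
    omega

open Classical in
/-- Testing against the cone around `a ℓ` counts the mass of the right sign near `a ℓ`. -/
lemma abs_le_sum_abs_of_flat_le
    {X : Type*} [MetricSpace X] {ι κ : Type*} [Fintype ι] [Fintype κ]
    (a : ι → X) (d : ι → ℤ) (b : κ → X) (e : κ → ℤ)
    (s : ℝ) (hs : 0 < s) (hs2 : s ≤ 1/2)
    (hsep : ∀ ℓ ℓ', ℓ ≠ ℓ' → 4 * s < dist (a ℓ) (a ℓ'))
    (hflat : ∀ f : X → ℝ, (∀ x, |f x| ≤ 1) → LipschitzWith 1 f →
      |(∑ k, (e k : ℝ) * f (b k)) - ∑ ℓ, (d ℓ : ℝ) * f (a ℓ)| ≤ s)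
    (ℓ : ι) (hd : d ℓ ≠ 0) :
    |d ℓ| ≤ ∑ k ∈ Finset.univ.filter
        (fun k => dist (b k) (a ℓ) ≤ 2 * s ∧ (e k).sign = (d ℓ).sign), |e k| := by
  set f : X → ℝ := distCone (a ℓ) (2 * s) with hf
  have hr : 0 ≤ 2 * s := by linarith
  have hf1 : ∀ x, |f x| ≤ 1 := fun x => by
    rw [abs_of_nonneg (distCone_nonneg _ x)]
    linarith [distCone_le (a ℓ) hr x]
  have key := hflat f hf1 (lipschitzWith_distCone _)
  have hsum : ∑ ℓ', (d ℓ' : ℝ) * f (a ℓ') = d ℓ * (2 * s) := by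
    rw [Finset.sum_eq_single ℓ, hf, distCone_self _ hr]
    · intro ℓ' _ hne
      rw [hf, distCone_eq_zero _ (by linarith [hsep ℓ' ℓ hne]), mul_zero]
    · simp
  rw [hsum] at key
  set N : ℤ := ∑ k ∈ Finset.univ.filter
        (fun k => dist (b k) (a ℓ) ≤ 2 * s ∧ (e k).sign = (d ℓ).sign), |e k| with hN
  have hup : ((d ℓ).sign : ℝ) * ∑ k, (e k : ℝ) * f (b k) ≤ N * (2 * s) := by
    rw [hN, Finset.sum_filter, Int.cast_sum, Finset.mul_sum, Finset.sum_mul]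
    refine Finset.sum_le_sum fun k _ => ?_
    by_cases hk : dist (b k) (a ℓ) ≤ 2 * s
    · have h1 := sign_mul_le_ite_abs (d ℓ) (e k) hd
      have h0 : (0 : ℤ) ≤ if (e k).sign = (d ℓ).sign then |e k| else 0 := by
        split_ifs <;> simp
      simp only [hk, true_and]
      have h1' : ((d ℓ).sign : ℝ) * e k ≤
          ((if (e k).sign = (d ℓ).sign then |e k| else 0 : ℤ) : ℝ) := by exact_mod_cast h1
      have h0' : (0 : ℝ) ≤ ((if (e k).sign = (d ℓ).sign then |e k| else 0 : ℤ) : ℝ) := by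
        exact_mod_cast h0
      rw [← mul_assoc]
      exact mul_le_mul h1' (distCone_le _ hr _) (distCone_nonneg _ _) h0'
    · simp [hk, hf, distCone_eq_zero (a ℓ) (not_le.mp hk).le]
  have hlow : ((|d ℓ| : ℤ) : ℝ) * (2 * s) - s ≤
      ((d ℓ).sign : ℝ) * ∑ k, (e k : ℝ) * f (b k) := by
    rw [abs_le] at key
    rcases lt_or_gt_of_ne hd with h | h
    · rw [Int.sign_eq_neg_one_of_neg h, abs_of_neg h]
      push_cast
      linarith [key.2]
    · rw [Int.sign_eq_one_of_pos h, abs_of_pos h]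
      push_cast
      linarith [key.1]
  by_contra! hlt
  have h2 : (N : ℝ) + 1 ≤ ((|d ℓ| : ℤ) : ℝ) := by exact_mod_cast hlt
  nlinarith

/- STATEMENT 13: degree counting under flat (`W^{−1,1}`-type) closeness of two
integer combinations of Dirac masses, with well-separated limit points.
The flat closeness is expressed by testing against all functions `f` with
`sup|f| ≤ 1` and Lipschitz constant ≤ 1. -/
open Classical in
theorem degree_counting_flat_distance
    {X : Type*} [MetricSpace X]
    {m K : ℕ} (a : Fin m → X) (d : Fin m → ℤ)
    (ha : Function.Injective a) (hd : ∀ ℓ, d ℓ ≠ 0)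
    (b : Fin K → X) (e : Fin K → ℤ)
    (s : ℝ) (hs : 0 < s) (hs2 : s ≤ 1/2)
    (hsep : ∀ ℓ ℓ', ℓ ≠ ℓ' → 4 * s < dist (a ℓ) (a ℓ'))
    (hflat : ∀ f : X → ℝ, (∀ x, |f x| ≤ 1) → LipschitzWith 1 f →
      |(∑ k, (e k : ℝ) * f (b k)) - ∑ ℓ, (d ℓ : ℝ) * f (a ℓ)| ≤ s) :
    (∀ ℓ, |d ℓ| ≤ ∑ k ∈ Finset.univ.filter
        (fun k => dist (b k) (a ℓ) ≤ 2 * s ∧ (e k).sign = (d ℓ).sign), |e k|) ∧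
    ((∑ k, |e k|) ≤ (∑ ℓ, |d ℓ|) →
      ((∑ k, |e k|) = (∑ ℓ, |d ℓ|) ∧
       (∀ k, e k ≠ 0 → ∃ ℓ, dist (b k) (a ℓ) ≤ 2 * s ∧ (e k).sign = (d ℓ).sign) ∧
       (∀ ℓ, (∑ k ∈ Finset.univ.filter (fun k => dist (b k) (a ℓ) ≤ 2 * s), e k) = d ℓ))) := by
  have hi := fun ℓ => abs_le_sum_abs_of_flat_le a d b e s hs hs2 hsep hflat ℓ (hd ℓ)
  refine ⟨hi, fun hle => ?_⟩
  have huniq : ∀ k ℓ ℓ', dist (b k) (a ℓ) ≤ 2 * s → dist (b k) (a ℓ') ≤ 2 * s → ℓ = ℓ' := by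
    intro k ℓ ℓ' h h'
    by_contra hne
    linarith [hsep ℓ ℓ' hne, dist_triangle_left (a ℓ) (a ℓ') (b k)]
  set S : Fin m → Finset (Fin K) := fun ℓ => Finset.univ.filter
    (fun k => dist (b k) (a ℓ) ≤ 2 * s ∧ (e k).sign = (d ℓ).sign) with hS
  have hdisj : ((Finset.univ : Finset (Fin m)) : Set (Fin m)).PairwiseDisjoint S := by
    intro ℓ _ ℓ' _ hne
    refine Finset.disjoint_left.mpr fun k hk hk' => hne ?_
    exact huniq k ℓ ℓ' (Finset.mem_filter.mp hk).2.1 (Finset.mem_filter.mp hk').2.1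
  have hU := Finset.sum_biUnion (f := fun k => |e k|) hdisj
  have hUle : ∑ k ∈ Finset.univ.biUnion S, |e k| ≤ ∑ k, |e k| :=
    Finset.sum_le_sum_of_subset_of_nonneg (Finset.subset_univ _) fun _ _ _ => abs_nonneg _
  have hdle : ∑ ℓ, |d ℓ| ≤ ∑ ℓ, ∑ k ∈ S ℓ, |e k| := Finset.sum_le_sum fun ℓ _ => hi ℓ
  have hmatch : ∀ k, e k ≠ 0 →
      ∃ ℓ, dist (b k) (a ℓ) ≤ 2 * s ∧ (e k).sign = (d ℓ).sign := by
    intro k hk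
    by_contra hno
    have hkU : k ∉ Finset.univ.biUnion S := fun h => by
      obtain ⟨ℓ, -, hℓ⟩ := Finset.mem_biUnion.mp h
      exact hno ⟨ℓ, (Finset.mem_filter.mp hℓ).2⟩
    have hlt : ∑ k ∈ Finset.univ.biUnion S, |e k| < ∑ k, |e k| :=
      Finset.sum_lt_sum_of_subset (Finset.subset_univ _) (Finset.mem_univ k) hkU
        (abs_pos.mpr hk) fun _ _ _ => abs_nonneg _
    linarith
  refine ⟨by linarith, hmatch, fun ℓ => ?_⟩
  have heq : |d ℓ| = ∑ k ∈ S ℓ, |e k| :=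
    (Finset.sum_eq_sum_iff_of_le fun ℓ _ => hi ℓ).mp (by linarith) ℓ (Finset.mem_univ ℓ)
  have hsub : S ℓ ⊆ Finset.univ.filter (fun k => dist (b k) (a ℓ) ≤ 2 * s) :=
    Finset.monotone_filter_right _ fun _ _ h => h.1
  rw [← Finset.sum_subset hsub, ← Int.sign_mul_abs (d ℓ), heq, Finset.mul_sum]
  · refine Finset.sum_congr rfl fun k hk => ?_
    rw [← (Finset.mem_filter.mp hk).2.2, Int.sign_mul_abs]
  · intro k hk hkS
    by_contra hne
    obtain ⟨ℓ', h1, h2⟩ := hmatch k hne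
    obtain rfl := huniq k ℓ ℓ' (Finset.mem_filter.mp hk).2 h1
    exact hkS (Finset.mem_filter.mpr ⟨Finset.mem_univ _, h1, h2⟩)
end
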